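/- Let P be a finite set of points in ℝ^d, let s be a service function, let ε ∈ (0,1), and let L ⊆ ℝ^d with |L| = k ≥ 1 be locally optimal under single swaps, i.e., for every c ∈ L and every a ∈ ℝ^d one has ρ((L∖{c})∪{a}) ≤ ρ(L). Then for every finite set B ⊆ ℝ^d with |B| ≤ εk/4 we have ρ(L∪B) ≤ (1 + ε/4)·ρ(L). -/

import Mathlib

open Metric Finset

abbrev Pt (d : ℕ) := EuclideanSpace ℝ (Fin d)

noncomputable instance {d : ℕ} : DecidableEq (Pt d) := Classical.decEq _

/-- A service function: monotonically non-increasing and non-negative on `[0, ∞)`. -/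
def IsServiceFunction (s : ℝ → ℝ) : Prop :=
  (∀ x, 0 ≤ x → 0 ≤ s x) ∧ (∀ x y, 0 ≤ x → x ≤ y → s y ≤ s x)

/-- The service (profit) `ρ(C) = Σ_{p ∈ P} s(dist(p, C))`, with `ρ(∅) = 0`. -/
noncomputable def profit {d : ℕ} (P : Finset (Pt d)) (s : ℝ → ℝ)
    (C : Finset (Pt d)) : ℝ :=
  if C.Nonempty then ∑ p ∈ P, s (Metric.infDist p (C : Set (Pt d))) else 0

/-- The marginal value `mrg(a, C) = ρ(C ∪ {a}) − ρ(C ∖ {a})`. -/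
noncomputable def mrg {d : ℕ} (P : Finset (Pt d)) (s : ℝ → ℝ) (a : Pt d)
    (C : Finset (Pt d)) : ℝ :=
  profit P s (insert a C) - profit P s (C.erase a)

lemma profit_of_nonempty {d : ℕ} (P : Finset (Pt d)) (s : ℝ → ℝ) {C : Finset (Pt d)}
    (hC : C.Nonempty) :
    profit P s C = ∑ p ∈ P, s (Metric.infDist p (C : Set (Pt d))) :=
  if_pos hC

namespace IsServiceFunction

variable {d : ℕ} {s : ℝ → ℝ}

lemma infDist_nonneg (hs : IsServiceFunction s) (p : Pt d) (C : Finset (Pt d)) :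
    0 ≤ s (Metric.infDist p (C : Set (Pt d))) :=
  hs.1 _ Metric.infDist_nonneg

/-- Every facility of `C` provides at most the service of `C`. -/
lemma dist_le (hs : IsServiceFunction s) (p : Pt d) {C : Finset (Pt d)} {q : Pt d}
    (hq : q ∈ C) : s (dist p q) ≤ s (Metric.infDist p (C : Set (Pt d))) :=
  hs.2 _ _ Metric.infDist_nonneg (Metric.infDist_le_dist_of_mem (mem_coe.2 hq))

end IsServiceFunction

lemma exists_mem_infDist_eq_dist {d : ℕ} (p : Pt d) {C : Finset (Pt d)} (hC : C.Nonempty) :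
    ∃ q ∈ C, Metric.infDist p (C : Set (Pt d)) = dist p q :=
  C.finite_toSet.isCompact.exists_infDist_eq_dist (coe_nonempty.2 hC) p

lemma profit_nonneg {d : ℕ} (P : Finset (Pt d)) {s : ℝ → ℝ} (hs : IsServiceFunction s)
    (C : Finset (Pt d)) : 0 ≤ profit P s C := by
  unfold profit
  split_ifs
  · exact sum_nonneg fun p _ => hs.infDist_nonneg p C
  · exact le_rfl

/-- The gain of adding `B` is at most the sum of the gains of adding its single points. -/
lemma profit_union_sub_le_sum {d : ℕ} (P : Finset (Pt d)) {s : ℝ → ℝ}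
    (hs : IsServiceFunction s) {L : Finset (Pt d)} (hL : L.Nonempty) (B : Finset (Pt d)) :
    profit P s (L ∪ B) - profit P s L ≤
      ∑ b ∈ B, (profit P s (insert b L) - profit P s L) := by
  simp only [profit_of_nonempty P s hL, profit_of_nonempty P s (hL.mono subset_union_left),
    profit_of_nonempty P s (insert_nonempty _ L), ← sum_sub_distrib]
  rw [sum_comm]
  refine sum_le_sum fun p _ => ?_
  have gain_nonneg : ∀ b ∈ B, 0 ≤ s (Metric.infDist p (insert b L : Finset (Pt d))) -
      s (Metric.infDist p (L : Set (Pt d))) := fun b _ => by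
    obtain ⟨q, hq, hpq⟩ := exists_mem_infDist_eq_dist p hL
    rw [hpq]
    exact sub_nonneg.2 (hs.dist_le p (mem_insert_of_mem hq))
  obtain ⟨q, hq, hpq⟩ := exists_mem_infDist_eq_dist p (hL.mono (subset_union_left (s₂ := B)))
  rw [hpq]
  rcases mem_union.1 hq with hq | hq
  · exact (sub_nonpos.2 (hs.dist_le p hq)).trans (sum_nonneg gain_nonneg)
  · exact (sub_le_sub_right (hs.dist_le p (mem_insert_self q L)) _).trans
      (single_le_sum gain_nonneg hq)

/-- Swapping `b` in for each facility in turn loses, in total, at most the service of `L`. -/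
lemma card_mul_profit_insert_le {d : ℕ} (P : Finset (Pt d)) {s : ℝ → ℝ}
    (hs : IsServiceFunction s) {L : Finset (Pt d)} (hL : L.Nonempty) (b : Pt d) :
    (L.card : ℝ) * profit P s (insert b L) ≤
      ∑ c ∈ L, profit P s (insert b (L.erase c)) + profit P s L := by
  simp only [profit_of_nonempty P s hL, profit_of_nonempty P s (insert_nonempty _ _)]
  rw [sum_comm, mul_sum, ← sum_add_distrib]
  refine sum_le_sum fun p _ => ?_
  obtain ⟨n, hn, hpn⟩ := exists_mem_infDist_eq_dist p hL
  have swap_le : ∀ c ∈ L, s (Metric.infDist p (insert b L : Finset (Pt d))) ≤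
      s (Metric.infDist p (insert b (L.erase c) : Finset (Pt d))) +
        if c = n then s (Metric.infDist p (L : Set (Pt d))) else 0 := fun c _ => by
    obtain ⟨q, hq, hpq⟩ := exists_mem_infDist_eq_dist p (insert_nonempty b L)
    have swap_nonneg := hs.infDist_nonneg p (insert b (L.erase c))
    have old_nonneg := hs.infDist_nonneg p L
    rw [hpq]
    rcases mem_insert.1 hq with rfl | hq
    · have := hs.dist_le p (mem_insert_self q (L.erase c))
      split_ifs <;> linarith
    · have old_le := hs.dist_le p hq
      split_ifs with hc
      · linarith
      · have := hs.dist_le p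
          (mem_insert_of_mem (a := n) (b := b) (mem_erase.2 ⟨Ne.symm hc, hn⟩))
        rw [hpn] at old_le
        linarith
  have := sum_le_sum swap_le
  rwa [sum_const, nsmul_eq_mul, sum_add_distrib, sum_ite_eq' L n, if_pos hn] at this

/-- If `L` (of size `k ≥ 1`) is locally optimal under single swaps, then adding any
set `B` of at most `εk/4` points increases the service by at most a factor
`1 + ε/4`. -/
theorem stmt_9 {d : ℕ} (P : Finset (Pt d)) (s : ℝ → ℝ) (hs : IsServiceFunction s)
    (ε : ℝ) (hε : ε ∈ Set.Ioo (0 : ℝ) 1)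
    (L : Finset (Pt d)) (k : ℕ) (hLk : L.card = k) (hk : 1 ≤ k)
    (hloc : ∀ c ∈ L, ∀ a : Pt d, profit P s (insert a (L.erase c)) ≤ profit P s L) :
    ∀ B : Finset (Pt d), (B.card : ℝ) ≤ ε * k / 4 →
      profit P s (L ∪ B) ≤ (1 + ε / 4) * profit P s L := by
  intro B hB
  have hL : L.Nonempty := card_pos.1 (by omega)
  have k_pos : (0 : ℝ) < k := by exact_mod_cast hk
  have gain_le : ∀ b ∈ B, profit P s (insert b L) - profit P s L ≤ profit P s L / k := by
    intro b _
    have swaps_le := sum_le_sum fun c hc => hloc c hc b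
    have := card_mul_profit_insert_le P hs hL b
    rw [sum_const, nsmul_eq_mul] at swaps_le
    rw [hLk] at this swaps_le
    rw [le_div_iff₀ k_pos]
    linarith
  have total := (profit_union_sub_le_sum P hs hL B).trans (sum_le_sum gain_le)
  rw [sum_const, nsmul_eq_mul] at total
  have bound : (B.card : ℝ) * (profit P s L / k) ≤ ε * k / 4 * (profit P s L / k) :=
    mul_le_mul_of_nonneg_right hB (div_nonneg (profit_nonneg P hs L) k_pos.le)
  have : ε * k / 4 * (profit P s L / k) = ε / 4 * profit P s L := by
    field_simp
  linarith
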